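/- arXiv:1710.09336 — 2 statements merged into one kernel-verified Lean document; each statement's English description precedes it below -/
import Mathlib

section
/- Let T be a set of first-order L-sentences. If there exists a properly ergodic structure μ with μ(⟦φ⟧) = 1 for every φ ∈ T, then T has continuum-many countable models up to isomorphism: there is a family (M_x)_{x ∈ 2^ℕ} of structures in Str_L, pairwise non-isomorphic, each of which models T. -/
open FirstOrder Language MeasureTheory Set
open scoped ENNReal

namespace Ergo


/-- The space of L-structures with domain ℕ. -/
abbrev StrL (L : FirstOrder.Language.{0,0}) : Type :=
  ∀ n : ℕ, L.Relations n → (Fin n → ℕ) → Bool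

variable (L : FirstOrder.Language.{0,0})

/-- The L-structure on ℕ coded by a point of `StrL L`. -/
def toStructure [L.IsRelational] (x : StrL L) : L.Structure ℕ where
  funMap := fun f _ => isEmptyElim f
  RelMap := fun {n} r a => x n r a = true

/-- The logic action of a permutation of ℕ on `StrL L`. -/
def act (σ : Equiv.Perm ℕ) (x : StrL L) : StrL L :=
  fun n r a => x n r (fun i => σ.symm (a i))

/-- Satisfaction of a sentence at a point of `StrL L`. -/
def SatS [L.IsRelational] (x : StrL L) (φ : L.Sentence) : Prop :=
  letI := toStructure L x
  Sentence.Realize ℕ φ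

/-- Satisfaction of a formula at a point of `StrL L` under an assignment. -/
def SatF [L.IsRelational] (x : StrL L) {n : ℕ} (φ : L.Formula (Fin n)) (a : Fin n → ℕ) : Prop :=
  letI := toStructure L x
  Formula.Realize φ a

/-- `⟦φ⟧`, the set of structures satisfying the sentence φ. -/
def extS [L.IsRelational] (φ : L.Sentence) : Set (StrL L) := {x | SatS L x φ}

/-- `⟦φ(ā)⟧`, the set of structures satisfying φ(ā). -/
def extF [L.IsRelational] {n : ℕ} (φ : L.Formula (Fin n)) (a : Fin n → ℕ) : Set (StrL L) :=
  {x | SatF L x φ a}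

/-- Invariance of a measure under the logic action. -/
def Invariant (μ : Measure (StrL L)) : Prop :=
  ∀ (σ : Equiv.Perm ℕ) (X : Set (StrL L)), MeasurableSet X → μ (act L σ '' X) = μ X

/-- An ergodic structure: an ergodic invariant Borel probability measure on `StrL L`. -/
def IsErgodicStructure (μ : Measure (StrL L)) : Prop :=
  IsProbabilityMeasure μ ∧ Invariant L μ ∧
    ∀ X : Set (StrL L), MeasurableSet X →
      (∀ σ : Equiv.Perm ℕ, μ (symmDiff X (act L σ '' X)) = 0) → μ X = 0 ∨ μ X = 1

/-- The isomorphism class (orbit of the logic action) of a point of `StrL L`. -/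
def IsoClass (M : StrL L) : Set (StrL L) := {N | ∃ σ : Equiv.Perm ℕ, act L σ M = N}

/-- All isomorphism classes are null: the defining property of proper ergodicity. -/
def OrbitsNull (μ : Measure (StrL L)) : Prop := ∀ M : StrL L, μ (IsoClass L M) = 0

/-- Realization of a formula in an explicitly given structure. -/
def RealizeIn (M : Type) (iM : L.Structure M) {n : ℕ} (φ : L.Formula (Fin n))
    (a : Fin n → M) : Prop :=
  letI := iM
  Formula.Realize φ a

/-- Satisfaction of a sentence in an explicitly given structure. -/
def SatSIn (M : Type) (iM : L.Structure M) (φ : L.Sentence) : Prop :=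
  letI := iM
  Sentence.Realize M φ

/-- A complete first-order n-type: the set of formulas satisfied by a fixed tuple
in some L-structure. -/
def IsCompleteType (n : ℕ) (p : Set (L.Formula (Fin n))) : Prop :=
  ∃ (M : Type) (iM : L.Structure M) (a : Fin n → M), p = {φ | RealizeIn L M iM φ a}

/-- A complete quantifier-free n-type. -/
def IsQfCompleteType (n : ℕ) (p : Set (L.Formula (Fin n))) : Prop :=
  ∃ (M : Type) (iM : L.Structure M) (a : Fin n → M),
    p = {φ | φ.IsQF ∧ RealizeIn L M iM φ a}

/-- A type is non-redundant if it contains `xᵢ ≠ xⱼ` for all `i ≠ j`. -/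
def NonRedundant (n : ℕ) (p : Set (L.Formula (Fin n))) : Prop :=
  ∀ i j : Fin n, i ≠ j → BoundedFormula.not (Term.equal (Term.var i) (Term.var j)) ∈ p

/-- The set of structures in which the canonical distinct tuple (0,…,n−1) realizes p;
`μ` of this set is the measure `μ(p)` of the type `p`. -/
def typeSet [L.IsRelational] {n : ℕ} (p : Set (L.Formula (Fin n))) : Set (StrL L) :=
  {x | ∀ φ ∈ p, SatF L x φ (fun i => (i : ℕ))}

/-- Realization of (all formulas of) a type in an explicit structure by a tuple. -/
def RealizesTypeIn (M : Type) (iM : L.Structure M) {n : ℕ} (p : Set (L.Formula (Fin n)))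
    (a : Fin n → M) : Prop :=
  ∀ φ ∈ p, RealizeIn L M iM φ a

/-- χ-rootedness with respect to quantifier-free types. -/
def ChiRootedQfOn (M : Type) (iM : L.Structure M) {n : ℕ} (χ : L.Formula (Fin n)) : Prop :=
  ∀ p : Set (L.Formula (Fin n)), IsQfCompleteType L n p → NonRedundant L n p → χ ∈ p →
    (∃ a, RealizesTypeIn L M iM p a) →
    ∃ r : M, ∀ a, RealizesTypeIn L M iM p a → ∃ i, a i = r

/-- χ-rootedness with respect to complete first-order types. -/
def ChiRootedFullOn (M : Type) (iM : L.Structure M) {n : ℕ} (χ : L.Formula (Fin n)) : Prop :=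
  ∀ p : Set (L.Formula (Fin n)), IsCompleteType L n p → NonRedundant L n p → χ ∈ p →
    (∃ a, RealizesTypeIn L M iM p a) →
    ∃ r : M, ∀ a, RealizesTypeIn L M iM p a → ∃ i, a i = r

section Analytic

open Filter Topology

/-- A sequence built by course-of-values recursion. -/
noncomputable def seqOf (step : ∀ n, (Fin n → ℕ) → ℕ) : ℕ → ℕ
  | n => step n fun i => seqOf step i
termination_by n => n
decreasing_by exact i.2

theorem exists_isCompact_subset_range_lt_measure {Y : Type*} [TopologicalSpace Y]
    [MeasurableSpace Y] (ν : Measure Y) [ν.OuterRegular]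
    {f : (ℕ → ℕ) → Y} (hf : Continuous f) {c : ℝ≥0∞} (hc : c < ν (range f)) :
    ∃ K ⊆ range f, IsCompact K ∧ c ≤ ν K := by
  let box (k : ℕ) (b : Fin k → ℕ) : Set (ℕ → ℕ) := {x | ∀ i : Fin k, x i ≤ b i}
  have step : ∀ k (b : Fin k → ℕ), ∃ m, c < ν (f '' box k b) →
      c < ν (f '' box (k + 1) (Fin.snoc b m)) := by
    intro k b
    by_cases h : c < ν (f '' box k b)
    · have hmono : Monotone fun m => f '' box (k + 1) (Fin.snoc b m) := by
        intro m m' hm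
        refine image_mono fun x hx i => (hx i).trans ?_
        refine Fin.lastCases ?_ (fun j => ?_) i <;> simp [hm]
      have hU : f '' box k b = ⋃ m, f '' box (k + 1) (Fin.snoc b m) := by
        rw [← image_iUnion]
        congr 1
        ext x
        simp only [mem_iUnion]
        constructor
        · intro hx
          refine ⟨x k, fun i => ?_⟩
          refine Fin.lastCases ?_ (fun j => ?_) i
          · simp
          · simpa using hx j
        · rintro ⟨m, hm⟩ i
          simpa using hm i.castSucc
      rw [hU, hmono.measure_iUnion, lt_iSup_iff] at h
      obtain ⟨m, hm⟩ := h
      exact ⟨m, fun _ => hm⟩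
    · exact ⟨0, fun h' => absurd h' h⟩
  choose g hg using step
  let b := seqOf g
  have hb : ∀ k, b k = g k fun i => b i := fun k => by
    simp only [b]
    rw [seqOf]
  have hbox : ∀ k, c < ν (f '' box k fun i => b i) := by
    intro k
    induction k with
    | zero => simpa [box] using hc
    | succ k ih =>
      have := hg k (fun i => b i) ih
      convert this using 4
      funext i
      refine Fin.lastCases ?_ (fun j => ?_) i
      · simpa using hb k
      · simp
  have hK : IsCompact (univ.pi fun i => Iic (b i)) :=
    isCompact_univ_pi fun i => (finite_Iic (b i)).isCompact
  refine ⟨f '' univ.pi fun i => Iic (b i), image_subset_range _ _, hK.image hf, ?_⟩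
  refine le_of_forall_gt fun r hr => ?_
  obtain ⟨U, hKU, hU, hUr⟩ := Set.exists_isOpen_lt_of_lt _ _ hr
  suffices ∃ k, (f '' box k fun i => b i) ⊆ U by
    obtain ⟨k, hk⟩ := this
    exact (hbox k).trans ((measure_mono hk).trans_lt hUr)
  by_contra! hcon
  simp only [not_subset, mem_image] at hcon
  have hcon' : ∀ k, ∃ x ∈ box k fun i => b i, f x ∉ U := fun k => by
    obtain ⟨_, ⟨x, hx, rfl⟩, h⟩ := hcon k
    exact ⟨x, hx, h⟩
  choose x hx hxU using hcon'
  let y (k : ℕ) : ℕ → ℕ := fun i => if i < k then x k i else 0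
  have hy : ∀ k, y k ∈ univ.pi fun i => Iic (b i) := by
    intro k i _
    by_cases h : i < k
    · simpa [y, h] using hx k ⟨i, h⟩
    · simp [y, h]
  obtain ⟨z, hz, φ, hφ, hlim⟩ := hK.tendsto_subseq hy
  have hlim' : Tendsto (x ∘ φ) atTop (𝓝 z) := by
    rw [tendsto_pi_nhds] at hlim ⊢
    intro i
    refine (hlim i).congr' ?_
    filter_upwards [eventually_gt_atTop i] with k hk
    simp [y, hk.trans_le (hφ.id_le k)]
  have : f z ∈ Uᶜ := hU.isClosed_compl.mem_of_tendsto ((hf.tendsto z).comp hlim')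
    (Eventually.of_forall fun k => hxU _)
  exact this (hKU ⟨z, hz, rfl⟩)

theorem AnalyticSet.measure_prod_null {X Y : Type*} [TopologicalSpace X] [TopologicalSpace Y]
    [PolishSpace X] [PolishSpace Y] [MeasurableSpace X] [MeasurableSpace Y] [BorelSpace X]
    [BorelSpace Y] (μ : Measure X) (ν : Measure Y) [IsFiniteMeasure μ] [IsFiniteMeasure ν]
    {E : Set (X × Y)} (hE : AnalyticSet E) (h : ∀ x, ν {y | (x, y) ∈ E} = 0) :
    μ.prod ν E = 0 := by
  let := TopologicalSpace.upgradeIsCompletelyMetrizable X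
  let := TopologicalSpace.upgradeIsCompletelyMetrizable Y
  rw [AnalyticSet] at hE
  rcases hE with rfl | ⟨f, hf, rfl⟩
  · simp
  by_contra hne
  obtain ⟨c, hc0, hc⟩ := exists_between (pos_iff_ne_zero.2 hne)
  obtain ⟨K, hKE, hK, hcK⟩ := exists_isCompact_subset_range_lt_measure _ hf hc
  refine (hc0.trans_le hcK).ne' ?_
  rw [Measure.prod_apply hK.measurableSet]
  have : ∀ x, ν (Prod.mk x ⁻¹' K) = 0 := fun x => measure_mono_null (fun y hy => hKE hy) (h x)
  simp [this]

end Analytic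

section Sample

open Filter Topology

variable {X : Type*} [MeasurableSpace X] (μ : Measure X) [IsProbabilityMeasure μ]

theorem measurePreserving_infinitePi_swap (i j : ℕ) :
    MeasurePreserving (fun (ω : ℕ → X) k => ω (Equiv.swap i j k))
      (Measure.infinitePi fun _ => μ) (Measure.infinitePi fun _ => μ) := by
  refine ⟨by fun_prop, ?_⟩
  convert! Measure.infinitePi_map_piCongrLeft (fun _ : ℕ => μ) (Equiv.swap i j) using 2
  funext ω k
  simp only [MeasurableEquiv.coe_piCongrLeft, Equiv.piCongrLeft_apply, Equiv.symm_swap]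
  exact (eq_rec_constant _ _).symm

theorem measurePreserving_infinitePi_pair {i j : ℕ} (hij : i ≠ j) :
    MeasurePreserving (fun ω : ℕ → X => (ω i, ω j))
      (Measure.infinitePi fun _ => μ) (μ.prod μ) := by
  refine ⟨by fun_prop, ?_⟩
  have h := (ProbabilityTheory.iIndepFun_infinitePi (P := fun _ : ℕ => μ)
    (X := fun _ x => x) (fun _ => measurable_id)).indepFun hij
  rw [ProbabilityTheory.indepFun_iff_map_prod_eq_prod_map_map 
    (measurable_pi_apply i).aemeasurable (measurable_pi_apply j).aemeasurable] at h
  rw [h, Measure.infinitePi_map_eval, Measure.infinitePi_map_eval]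

/-- In an i.i.d. sequence, a condition depending on finitely many other coordinates which is
satisfied by one coordinate is almost surely satisfied by a further one. -/
theorem ae_exists_ne_of_mem (T : Finset ℕ) {i : ℕ} (hi : i ∉ T) {B : Set (X × (ℕ → X))}
    (hB : MeasurableSet B)
    (hT : ∀ x ω ω', (∀ t ∈ T, ω t = ω' t) → (x, ω) ∈ B → (x, ω') ∈ B) :
    ∀ᵐ ω ∂(Measure.infinitePi fun _ : ℕ => μ),
      (ω i, ω) ∈ B → ∃ j ∉ T, j ≠ i ∧ (ω j, ω) ∈ B := by
  set P := Measure.infinitePi fun _ : ℕ => μ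
  let D (k : ℕ) : Set (ℕ → X) := {ω | (ω k, ω) ∈ B ∧ ∀ j ∉ T, j ≠ k → (ω j, ω) ∉ B}
  have hD : ∀ k, MeasurableSet (D k) := by
    intro k
    have hm : ∀ j, MeasurableSet {ω : ℕ → X | (ω j, ω) ∈ B} := fun j =>
      (show Measurable fun ω : ℕ → X => (ω j, ω) by fun_prop) hB
    have : D k = {ω | (ω k, ω) ∈ B} ∩
        ⋂ j, ⋂ (_ : j ∉ T), ⋂ (_ : j ≠ k), {ω | (ω j, ω) ∈ B}ᶜ := by
      ext ω
      simp [D]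
    rw [this]
    exact (hm k).inter <| .iInter fun j => .iInter fun _ => .iInter fun _ => (hm j).compl
  have hPD : ∀ k ∉ T, P (D k) = P (D i) := by
    intro k hk
    rw [← (measurePreserving_infinitePi_swap μ i k).measure_preimage (hD i).nullMeasurableSet]
    congr 1
    have hsw : ∀ t ∈ T, Equiv.swap i k t = t := fun t ht =>
      Equiv.swap_apply_of_ne_of_ne (fun h => hi (h ▸ ht)) (fun h => hk (h ▸ ht))
    have hswT : ∀ j ∉ T, Equiv.swap i k j ∉ T := by
      intro j hj h
      apply hj
      have := hsw _ h
      rw [Equiv.swap_apply_self] at this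
      exact this ▸ h
    have key : ∀ (ω : ℕ → X) x, (x, fun l => ω (Equiv.swap i k l)) ∈ B ↔ (x, ω) ∈ B :=
      fun ω x => ⟨hT _ _ _ fun t ht => by rw [hsw t ht], hT _ _ _ fun t ht => by rw [hsw t ht]⟩
    ext ω
    simp only [D, mem_preimage, mem_ofPred_eq, key, Equiv.swap_apply_left]
    refine and_congr_right fun _ => ⟨fun h j hj hjk => ?_, fun h j hj hji => ?_⟩
    · refine h _ (hswT j hj) fun h' => hjk ?_
      rw [← Equiv.swap_apply_self i k j, h', Equiv.swap_apply_right]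
    · have := h _ (hswT j hj) fun h' => hji ?_
      · rwa [Equiv.swap_apply_self] at this
      · rw [← Equiv.swap_apply_self i k j, h', Equiv.swap_apply_left]
  have hnull : P (D i) = 0 := by
    by_contra hne
    let K := {k : ℕ // k ∉ T}
    have : Infinite K := (T.finite_toSet.infinite_compl).to_subtype
    have hle : ∑' k : K, P (D k) ≤ P univ :=
      tsum_measure_le_measure_univ (fun k => (hD k).nullMeasurableSet) fun k l hkl =>
        Disjoint.aedisjoint <| disjoint_left.2 fun ω hk hl =>
          hl.2 k k.2 (fun h => hkl (Subtype.ext h)) hk.1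
    simp only [fun k : K => hPD k k.2] at hle
    rw [ENNReal.tsum_const_eq_top_of_ne_zero hne] at hle
    simp [P] at hle
  filter_upwards [measure_eq_zero_iff_ae_notMem.1 hnull] with ω hω hωi
  by_contra! hcon
  exact hω ⟨hωi, hcon⟩

theorem exists_recurrent_sample {X : Type*} [PseudoMetricSpace X] [SecondCountableTopology X]
    [MeasurableSpace X] [BorelSpace X] (μ : Measure X) [IsProbabilityMeasure μ]
    {C : ℕ → Set (X × X)} (hC : ∀ m, MeasurableSet (C m))
    (hfull : ∀ᵐ p ∂μ.prod μ, ∃ m, p ∈ C m) :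
    ∃ S : ℕ → X, (∀ i j, i ≠ j → ∃ m, (S i, S j) ∈ C m) ∧
      ∀ (T : Finset ℕ), ∀ i ∉ T, ∀ W : Finset (ℕ × ℕ),
        (∀ p ∈ W, p.1 ∈ T ∧ (S i, S p.1) ∈ C p.2) → ∀ ε > 0,
          ∃ j ∉ T, j ≠ i ∧ dist (S j) (S i) < ε ∧ ∀ p ∈ W, (S j, S p.1) ∈ C p.2 := by
  have : Nonempty X := nonempty_of_isProbabilityMeasure μ
  have h1 : ∀ᵐ ω ∂(Measure.infinitePi fun _ : ℕ => μ),
      ∀ i j, i ≠ j → ∃ m, (ω i, ω j) ∈ C m := by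
    simp only [ae_all_iff]
    intro i j hij
    exact (measurePreserving_infinitePi_pair μ hij).quasiMeasurePreserving.ae hfull
  let B (W : Finset (ℕ × ℕ)) (k r : ℕ) : Set (X × (ℕ → X)) :=
    {q | dist q.1 (TopologicalSpace.denseSeq X k) < 1 / (r + 1) ∧
      ∀ p ∈ W, (q.1, q.2 p.1) ∈ C p.2}
  have hB : ∀ W k r, MeasurableSet (B W k r) := by
    intro W k r
    have : B W k r = {q | dist q.1 (TopologicalSpace.denseSeq X k) < 1 / ((r : ℝ) + 1)} ∩
        ⋂ p ∈ W, (fun q : X × (ℕ → X) => (q.1, q.2 p.1)) ⁻¹' C p.2 := by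
      ext q
      simp [B]
    rw [this]
    refine (measurableSet_lt (measurable_fst.dist measurable_const) measurable_const).inter ?_
    refine .iInter fun p => .iInter fun _ => ?_
    exact (show Measurable fun q : X × (ℕ → X) => (q.1, q.2 p.1) by fun_prop) (hC p.2)
  have h2 : ∀ᵐ ω ∂(Measure.infinitePi fun _ : ℕ => μ), ∀ (T : Finset ℕ) (i : ℕ)
      (W : Finset (ℕ × ℕ)) (k r : ℕ), i ∉ T → (∀ p ∈ W, p.1 ∈ T) →
      (ω i, ω) ∈ B W k r → ∃ j ∉ T, j ≠ i ∧ (ω j, ω) ∈ B W k r := by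
    simp only [ae_all_iff]
    intro T i W k r hi hW
    refine ae_exists_ne_of_mem μ T hi (hB W k r) fun x ω ω' h hx => ⟨hx.1, fun p hp => ?_⟩
    have := hx.2 p hp
    simpa [h p.1 (hW p hp)] using this
  obtain ⟨S, hS1, hS2⟩ := (h1.and h2).exists
  refine ⟨S, hS1, fun T i hi W hW ε hε => ?_⟩
  obtain ⟨r, hr⟩ := exists_nat_one_div_lt (half_pos hε)
  obtain ⟨k, hk⟩ := (TopologicalSpace.denseRange_denseSeq X).exists_dist_lt (S i)
    (Nat.one_div_pos_of_nat (α := ℝ) (n := r))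
  obtain ⟨j, hjT, hji, hj, hjW⟩ := hS2 T i W k r hi (fun p hp => (hW p hp).1)
    ⟨hk, fun p hp => (hW p hp).2⟩
  refine ⟨j, hjT, hji, ?_, hjW⟩
  have := dist_triangle_right (S j) (S i) (TopologicalSpace.denseSeq X k)
  dsimp only at hj
  linarith
end Sample

section Tree

open Filter Topology

/-- The natural number whose binary digits are the first `K` values of `x`. -/
def label (x : ℕ → Bool) : ℕ → ℕ
  | 0 => 0
  | K + 1 => label x K + if x K then 2 ^ K else 0

theorem label_lt (x : ℕ → Bool) (K : ℕ) : label x K < 2 ^ K := by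
  induction K with
  | zero => simp [label]
  | succ K ih =>
    rw [label, pow_succ]
    split_ifs <;> omega

theorem exists_label_ne {x y : ℕ → Bool} (h : x ≠ y) : ∃ k, label x k ≠ label y k := by
  contrapose! h
  funext K
  have h1 := h (K + 1)
  rw [label, label, h K] at h1
  have : 2 ^ K ≠ 0 := by positivity
  cases hx : x K <;> cases hy : y K <;> simp_all

theorem sub_pow_log_add {K l : ℕ} (hl : l < 2 ^ K) :
    l + 2 ^ K - 2 ^ Nat.log 2 (l + 2 ^ K) = l := by
  rw [Nat.log_eq_of_pow_le_of_lt_pow (m := K) (by omega) (by rw [pow_succ]; omega)]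
  omega

/-- Points indexed by binary strings: `l + 2 ^ K` is the new copy of the node `l < 2 ^ K` at
level `K`. -/
theorem exists_splitting_sequence {X : Type*} [PseudoMetricSpace X] {C : ℕ → Set (X × X)}
    {S : ℕ → X} (m : ℕ → ℕ → ℕ)
    (hS : ∀ (T : Finset ℕ), ∀ i ∉ T, ∀ W : Finset (ℕ × ℕ),
        (∀ p ∈ W, p.1 ∈ T ∧ (S i, S p.1) ∈ C p.2) → ∀ ε > 0,
          ∃ j ∉ T, j ≠ i ∧ dist (S j) (S i) < ε ∧ ∀ p ∈ W, (S j, S p.1) ∈ C p.2) :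
    ∃ a : ℕ → ℕ, Function.Injective a ∧ ∀ K, ∀ l < 2 ^ K,
      dist (S (a (l + 2 ^ K))) (S (a l)) < (1 / 2) ^ K ∧
      ∀ t < l + 2 ^ K, t ≠ l → ∀ u < l + 2 ^ K, ∀ v < l + 2 ^ K,
        (S (a l), S (a t)) ∈ C (m (a u) (a v)) →
        (S (a (l + 2 ^ K)), S (a t)) ∈ C (m (a u) (a v)) := by
  classical
  have step : ∀ n (g : Fin n → ℕ), ∃ j, Function.Injective g → j ∉ range g ∧
      ∀ l : Fin n, n - 2 ^ Nat.log 2 n = l → dist (S j) (S (g l)) < (1 / 2) ^ n ∧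
        ∀ t ≠ l, ∀ u v, (S (g l), S (g t)) ∈ C (m (g u) (g v)) →
          (S j, S (g t)) ∈ C (m (g u) (g v)) := by
    intro n g
    rcases Nat.eq_zero_or_pos n with rfl | hn
    · exact ⟨0, fun _ => ⟨by simp, fun l => l.elim0⟩⟩
    by_cases hg : Function.Injective g
    swap
    · exact ⟨0, fun h => absurd h hg⟩
    let p : Fin n := ⟨n - 2 ^ Nat.log 2 n, Nat.sub_lt hn (by positivity)⟩
    let T := (Finset.univ.erase p).image g
    let W := (((Finset.univ.erase p) ×ˢ (Finset.univ ×ˢ Finset.univ)).image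
      fun q : Fin n × Fin n × Fin n => (g q.1, m (g q.2.1) (g q.2.2))).filter
        fun q => (S (g p), S q.1) ∈ C q.2
    obtain ⟨j, hjT, hjp, hj, hjW⟩ := hS T (g p)
      (by simp only [T, Finset.mem_image, Finset.mem_erase, not_exists, not_and]
          exact fun t ht h => ht.1 (hg h)) W
      (by intro q hq
          simp only [W, Finset.mem_filter, Finset.mem_image] at hq
          obtain ⟨⟨s, hs, rfl⟩, hq⟩ := hq
          exact ⟨Finset.mem_image_of_mem _ (Finset.mem_product.1 hs).1, hq⟩)
      ((1 / 2) ^ n) (by positivity)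
    refine ⟨j, fun _ => ⟨?_, fun l hl => ?_⟩⟩
    · rintro ⟨t, rfl⟩
      by_cases h : t = p
      · exact hjp (by rw [h])
      · exact hjT (Finset.mem_image_of_mem _ (by simpa using h))
    · obtain rfl : l = p := Fin.ext hl.symm
      refine ⟨hj, fun t ht u v h => hjW (g t, m (g u) (g v)) ?_⟩
      simp only [W, Finset.mem_filter, Finset.mem_image]
      exact ⟨⟨(t, u, v), by simpa using ht, rfl⟩, h⟩
  choose s hs using step
  let a := seqOf s
  have ha : ∀ n, a n = s n fun i => a i := fun n => by
    simp only [a]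
    rw [seqOf]
  have hinj : ∀ n, Function.Injective fun i : Fin n => a i := by
    intro n
    induction n with
    | zero => exact fun i => i.elim0
    | succ n ih =>
      have hn := (hs n _ ih).1
      rw [← ha] at hn
      intro i j
      refine Fin.lastCases ?_ (fun i => ?_) i <;> refine Fin.lastCases ?_ (fun j => ?_) j
      · simp
      · intro h
        exact absurd ⟨j, by simpa using h.symm⟩ hn
      · intro h
        exact absurd ⟨i, by simpa using h⟩ hn
      · intro h
        rw [ih h]
  refine ⟨a, fun i j h => ?_, fun K l hl => ?_⟩
  · have := @hinj (i + j + 1) ⟨i, by omega⟩ ⟨j, by omega⟩ h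
    simpa using this
  · have hlt : l < l + 2 ^ K := by omega
    obtain ⟨h1, h2⟩ := (hs _ _ (hinj (l + 2 ^ K))).2 ⟨l, hlt⟩ (sub_pow_log_add hl)
    rw [← ha] at h1 h2
    refine ⟨h1.trans_le ?_, fun t ht htl u hu v hv =>
      h2 ⟨t, ht⟩ (by simpa using htl) ⟨u, hu⟩ ⟨v, hv⟩⟩
    exact pow_le_pow_of_le_one (by norm_num) (by norm_num)
      (Nat.lt_two_pow_self.le.trans (Nat.le_add_left _ _))

theorem exists_cantor_family {X : Type*} [PseudoMetricSpace X] [CompleteSpace X]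
    {C : ℕ → Set (X × X)} (hC : ∀ m, IsClosed (C m)) (hsymm : ∀ m x y, (x, y) ∈ C m → (y, x) ∈ C m)
    {S : ℕ → X} (hS : ∀ i j, i ≠ j → ∃ m, (S i, S j) ∈ C m)
    (hS' : ∀ (T : Finset ℕ), ∀ i ∉ T, ∀ W : Finset (ℕ × ℕ),
        (∀ p ∈ W, p.1 ∈ T ∧ (S i, S p.1) ∈ C p.2) → ∀ ε > 0,
          ∃ j ∉ T, j ≠ i ∧ dist (S j) (S i) < ε ∧ ∀ p ∈ W, (S j, S p.1) ∈ C p.2) :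
    ∃ f : (ℕ → Bool) → X, ∀ x y, x ≠ y → ∃ m, (f x, f y) ∈ C m := by
  choose! m hm using hS
  obtain ⟨a, hinj, ha⟩ := exists_splitting_sequence m hS'
  have hlim : ∀ x, ∃ z, Tendsto (fun K => S (a (label x K))) atTop (𝓝 z) := by
    intro x
    refine cauchySeq_tendsto_of_complete (cauchySeq_of_le_geometric (1 / 2) 1 (by norm_num) ?_)
    intro K
    rw [dist_comm, one_mul, label]
    split_ifs
    · exact (ha K _ (label_lt x K)).1.le
    · simp
  choose f hf using hlim
  refine ⟨f, fun x y hxy => ?_⟩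
  obtain ⟨k, hk⟩ := exists_label_ne hxy
  refine ⟨m (a (label x k)) (a (label y k)), ?_⟩
  have hstep : ∀ K ≥ k, ∀ l < 2 ^ K, ∀ t < l + 2 ^ K, t ≠ l →
      (S (a l), S (a t)) ∈ C (m (a (label x k)) (a (label y k))) →
      (S (a (l + 2 ^ K)), S (a t)) ∈ C (m (a (label x k)) (a (label y k))) := by
    intro K hK l hl t ht htl
    have := Nat.pow_le_pow_right (n := 2) (by norm_num) hK
    exact (ha K l hl).2 t ht htl _ (by linarith [label_lt x k]) _ (by linarith [label_lt y k])
  have main : ∀ K ≥ k, label x K ≠ label y K ∧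
      (S (a (label x K)), S (a (label y K))) ∈ C (m (a (label x k)) (a (label y k))) := by
    intro K hK
    induction K, hK using Nat.le_induction with
    | base => exact ⟨hk, hm _ _ (hinj.ne hk)⟩
    | succ K hK ih =>
      obtain ⟨hne, hR⟩ := ih
      have hx := label_lt x K
      have hy := label_lt y K
      rw [label, label]
      generalize label x K = u at *
      generalize label y K = v at *
      split_ifs
      · refine ⟨by omega, ?_⟩
        rcases lt_or_gt_of_ne hne with h | h
        · refine hsymm _ _ _ (hstep K hK v hy _ (by omega) (by omega) (hsymm _ _ _ ?_))
          exact hstep K hK u hx v (by omega) (by omega) hR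
        · refine hstep K hK u hx _ (by omega) (by omega) (hsymm _ _ _ ?_)
          exact hstep K hK v hy u (by omega) (by omega) (hsymm _ _ _ hR)
      · exact ⟨by omega, hstep K hK u hx v (by omega) (by omega) hR⟩
      · exact ⟨by omega, hsymm _ _ _
          (hstep K hK v hy u (by omega) (by omega) (hsymm _ _ _ hR))⟩
      · exact ⟨by omega, hR⟩
  refine (hC _).mem_of_tendsto ((hf x).prodMk_nhds (hf y)) ?_
  filter_upwards [eventually_ge_atTop k] with K hK using (main K hK).2

/-- A measure-theoretic Mycielski theorem. -/
theorem exists_cantor_family_of_null {X : Type*} [TopologicalSpace X] [PolishSpace X]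
    [MeasurableSpace X] [BorelSpace X] (μ : Measure X) [IsProbabilityMeasure μ]
    {N : Set (X × X)} (hN : μ.prod μ N = 0) :
    ∃ f : (ℕ → Bool) → X, ∀ x y, x ≠ y → (f x, f y) ∉ N := by
  let := TopologicalSpace.upgradeIsCompletelyMetrizable X
  have hU : ∀ m : ℕ, ∃ U ⊇ N, IsOpen U ∧ μ.prod μ U < (m : ℝ≥0∞)⁻¹ := fun m =>
    N.exists_isOpen_lt_of_lt _ (by simp [hN])
  choose U hNU hU hUm using hU
  let C (m : ℕ) : Set (X × X) := (U m)ᶜ ∩ Prod.swap ⁻¹' (U m)ᶜ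
  have hC : ∀ m, IsClosed (C m) := fun m =>
    (hU m).isClosed_compl.inter ((hU m).isClosed_compl.preimage continuous_swap)
  have hfull : ∀ᵐ p ∂μ.prod μ, ∃ m, p ∈ C m := by
    rw [ae_iff]
    have hle : ∀ m : ℕ, μ.prod μ {p | ¬∃ m, p ∈ C m} ≤ 2 * (m : ℝ≥0∞)⁻¹ := by
      intro m
      have hsub : {p | ¬∃ m, p ∈ C m} ⊆ U m ∪ Prod.swap ⁻¹' U m := by
        intro p hp
        by_contra h
        exact hp ⟨m, by simpa [C] using h⟩
      have hswap : μ.prod μ (Prod.swap ⁻¹' U m) = μ.prod μ (U m) :=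
        Measure.measurePreserving_swap.measure_preimage (hU m).measurableSet.nullMeasurableSet
      calc _ ≤ μ.prod μ (U m) + μ.prod μ (Prod.swap ⁻¹' U m) :=
            (measure_mono hsub).trans (measure_union_le _ _)
        _ ≤ 2 * (m : ℝ≥0∞)⁻¹ := by
            rw [hswap, ← two_mul]
            gcongr
            exact (hUm m).le
    have hlim := ENNReal.Tendsto.const_mul ENNReal.tendsto_inv_nat_nhds_zero
      (Or.inr (ENNReal.ofNat_ne_top (n := 2)))
    rw [mul_zero] at hlim
    exact le_antisymm (ge_of_tendsto' hlim hle) bot_le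
  obtain ⟨S, hS, hS'⟩ := exists_recurrent_sample μ (fun m => (hC m).measurableSet) hfull
  obtain ⟨f, hf⟩ := exists_cantor_family hC (fun m x y h => ⟨h.2, h.1⟩) hS hS'
  refine ⟨f, fun x y hxy h => ?_⟩
  obtain ⟨m, hm⟩ := hf x y hxy
  exact hm.1 (hNU m h)

end Tree

section Models

instance polishSpace_strL [∀ n, Countable (L.Relations n)] : PolishSpace (StrL L) := .mk

instance opensMeasurableSpace_strL_prod [∀ n, Countable (L.Relations n)] :
    OpensMeasurableSpace (StrL L × StrL L) :=
  Prod.opensMeasurableSpace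

theorem analyticSet_isomorphic [∀ n, Countable (L.Relations n)] :
    AnalyticSet {p : StrL L × StrL L | p.2 ∈ IsoClass L p.1} := by
  let Z : Set (((ℕ → ℕ) × (ℕ → ℕ)) × StrL L) :=
    {z | ∀ k, z.1.1 (z.1.2 k) = k ∧ z.1.2 (z.1.1 k) = k}
  let F : ((ℕ → ℕ) × (ℕ → ℕ)) × StrL L → StrL L × StrL L :=
    fun z => (z.2, fun n r a => z.2 n r fun i => z.1.2 (a i))
  have hev : Measurable fun q : (ℕ → ℕ) × ℕ => q.1 q.2 :=
    measurable_from_prod_countable_left fun k => measurable_pi_apply k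
  have hZ : MeasurableSet Z := by
    have : Z = ⋂ k, {z | z.1.1 (z.1.2 k) = k} ∩ {z | z.1.2 (z.1.1 k) = k} := by
      ext z
      simp [Z]
    rw [this]
    refine .iInter fun k => .inter (measurableSet_eq_fun ?_ measurable_const)
      (measurableSet_eq_fun ?_ measurable_const)
    · exact hev.comp (measurable_fst.fst.prodMk ((measurable_pi_apply k).comp measurable_fst.snd))
    · exact hev.comp (measurable_fst.snd.prodMk ((measurable_pi_apply k).comp measurable_fst.fst))
  have hF : Measurable F := by
    refine measurable_snd.prodMk ?_
    refine measurable_pi_iff.2 fun n => measurable_pi_iff.2 fun r => measurable_pi_iff.2 fun a => ?_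
    have hev' : Measurable fun q : ((Fin n → ℕ) → Bool) × (Fin n → ℕ) => q.1 q.2 :=
      measurable_from_prod_countable_left fun k => measurable_pi_apply k
    refine hev'.comp (Measurable.prodMk ?_ ?_)
    · exact (measurable_pi_apply r).comp ((measurable_pi_apply n).comp measurable_snd)
    · exact measurable_pi_iff.2 fun i => (measurable_pi_apply (a i)).comp measurable_fst.snd
  have himage : {p : StrL L × StrL L | p.2 ∈ IsoClass L p.1} = F '' Z := by
    ext ⟨x, y⟩
    constructor
    · rintro ⟨σ, hσ⟩
      exact ⟨((σ, σ.symm), x), fun k => by simp, Prod.ext rfl hσ⟩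
    · rintro ⟨⟨⟨g, g'⟩, x'⟩, hz, h⟩
      obtain ⟨rfl, rfl⟩ := Prod.ext_iff.1 h
      exact ⟨⟨g, g', fun k => (hz k).2, fun k => (hz k).1⟩, rfl⟩
  rw [himage]
  exact hZ.analyticSet_image hF

theorem measurableSet_realize [L.IsRelational] {α : Type*} {n : ℕ} (φ : L.BoundedFormula α n)
    (v : α → ℕ) (xs : Fin n → ℕ) :
    MeasurableSet {x : StrL L | letI := toStructure L x; φ.Realize v xs} := by
  have hterm : ∀ {m : ℕ} (t : L.Term (α ⊕ Fin m)) (ys : Fin m → ℕ), ∃ k, ∀ x : StrL L,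
      (letI := toStructure L x; Term.realize (Sum.elim v ys) t) = k := by
    intro m t ys
    cases t with
    | var i => exact ⟨_, fun x => rfl⟩
    | func f _ => exact isEmptyElim f
  induction φ with
  | falsum => exact MeasurableSet.empty
  | equal t₁ t₂ =>
    obtain ⟨k₁, h₁⟩ := hterm t₁ xs
    obtain ⟨k₂, h₂⟩ := hterm t₂ xs
    have : ∀ x : StrL L, (letI := toStructure L x;
        (BoundedFormula.equal t₁ t₂).Realize v xs) ↔ k₁ = k₂ := fun x => by
      simp only [BoundedFormula.Realize, h₁, h₂]
    simp only [this]
    exact MeasurableSet.const _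
  | rel R ts =>
    choose k hk using fun i => hterm (ts i) xs
    have : ∀ x : StrL L, (letI := toStructure L x;
        (BoundedFormula.rel R ts).Realize v xs) ↔ x _ R k = true := fun x => by
      simp only [BoundedFormula.Realize, hk]
      rfl
    simp only [this]
    exact (show Measurable fun x : StrL L => x _ R k by fun_prop) (measurableSet_singleton true)
  | imp f₁ f₂ ih₁ ih₂ => exact (ih₁ xs).imp (ih₂ xs)
  | all f ih =>
    have : {x : StrL L | letI := toStructure L x; (BoundedFormula.all f).Realize v xs} =
        ⋂ a, {x | letI := toStructure L x; f.Realize v (Fin.snoc xs a)} := by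
      ext x
      simp only [mem_iInter]
      rfl
    rw [this]
    exact .iInter fun a => ih _

theorem measurableSet_extS [L.IsRelational] (φ : L.Sentence) : MeasurableSet (extS L φ) :=
  measurableSet_realize L φ _ _

end Models

/-- Vaught's Conjecture for ergodic structures, first-order instance: if some properly
ergodic structure almost surely satisfies a set T of first-order sentences, then T has
continuum-many countable models up to isomorphism. -/
theorem statement7 [L.IsRelational] [∀ n, Countable (L.Relations n)]
    (T : Set L.Sentence)
    (h : ∃ μ : Measure (StrL L), IsErgodicStructure L μ ∧ OrbitsNull L μ ∧
      ∀ φ ∈ T, μ (extS L φ) = 1) :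
    ∃ f : (ℕ → Bool) → StrL L,
      (∀ x y : ℕ → Bool, x ≠ y → ¬ ∃ σ : Equiv.Perm ℕ, act L σ (f x) = f y) ∧
      ∀ (x : ℕ → Bool), ∀ φ ∈ T, SatS L (f x) φ := by
  obtain ⟨μ, ⟨hμ, -, -⟩, horb, hT⟩ := h
  have hfun : IsEmpty (Σ n, L.Functions n) := ⟨fun f => isEmptyElim f.2⟩
  have : Countable L.Symbols :=
    inferInstanceAs (Countable ((Σ n, L.Functions n) ⊕ (Σ n, L.Relations n)))
  have : Countable L.Sentence := inferInstanceAs (Countable (L.Formula Empty))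
  have hTcount : T.Countable := T.to_countable
  have hE : μ.prod μ {p : StrL L × StrL L | p.2 ∈ IsoClass L p.1} = 0 :=
    AnalyticSet.measure_prod_null μ μ (analyticSet_isomorphic L) horb
  have hA : ∀ᵐ x ∂μ, ∀ φ ∈ T, SatS L x φ :=
    (ae_ball_iff hTcount).2 fun φ hφ =>
      (mem_ae_iff_prob_eq_one (measurableSet_extS L φ)).2 (hT φ hφ)
  have hN : μ.prod μ {p : StrL L × StrL L |
      ¬(p.2 ∉ IsoClass L p.1 ∧ ∀ φ ∈ T, SatS L p.1 φ)} = 0 := by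
    refine ae_iff.1 (.and (measure_eq_zero_iff_ae_notMem.1 hE) ?_)
    exact Measure.quasiMeasurePreserving_fst.ae hA
  obtain ⟨f, hf⟩ := exists_cantor_family_of_null μ hN
  refine ⟨f, fun x y hxy hiso => (not_not.1 (hf x y hxy)).1 hiso, fun x => ?_⟩
  have hne : x ≠ fun n => !x n := fun h => by simpa using congrFun h 0
  exact (not_not.1 (hf x _ hne)).2

end Ergo
end

section
/- Let μ be an ergodic structure, let n ≥ 1, and let χ(x̄) be a quantifier-free first-order formula in the n variables x₀,…,x_{n−1} such that: μ(χ(x̄)) > 0; μ(⟦χ(b̄)⟧) = 0 for every n-tuple b̄ from ℕ with a repeated entry; and μ(p) = 0 for every non-redundant complete quantifier-free n-type p containing χ. Then the set of structures M ∈ Str_L that are χ-rooted with respect to quantifier-free types is a Borel subset of Str_L of μ-measure 1. -/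
open FirstOrder Language MeasureTheory Set
open scoped ENNReal

namespace Ergo


variable (L : FirstOrder.Language.{0,0})

section Helpers

variable {L}

/-- Codes for quantifier-free `n`-types: the truth values of all relations on the variables. -/
abbrev QfCode (L : FirstOrder.Language.{0,0}) (n : ℕ) : Type :=
  ∀ k : ℕ, L.Relations k → (Fin k → Fin n) → Bool

/-- The code of the quantifier-free type of the tuple `a` in the structure `x`. -/
def qfCode {n : ℕ} (a : Fin n → ℕ) (x : StrL L) : QfCode L n :=
  fun k r s => x k r (a ∘ s)

lemma measurable_qfCode {n : ℕ} (a : Fin n → ℕ) :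
    Measurable (qfCode a : StrL L → QfCode L n) := by
  unfold qfCode
  fun_prop

lemma measurable_act (σ : Equiv.Perm ℕ) : Measurable (act L σ) := by
  unfold act
  fun_prop

lemma act_act (σ τ : Equiv.Perm ℕ) (x : StrL L) : act L σ (act L τ x) = act L (σ * τ) x := rfl

lemma act_one (x : StrL L) : act L 1 x = x := rfl

lemma act_iterate (σ : Equiv.Perm ℕ) (m : ℕ) (x : StrL L) :
    (act L σ)^[m] x = act L (σ ^ m) x := by
  induction m with
  | zero => rfl
  | succ m ih => rw [Function.iterate_succ_apply', ih, act_act, pow_succ']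

lemma image_act (σ : Equiv.Perm ℕ) (X : Set (StrL L)) : act L σ '' X = act L σ⁻¹ ⁻¹' X := by
  refine congrFun (Set.image_eq_preimage_of_inverse ?_ ?_) X
  · intro x; rw [act_act, inv_mul_cancel, act_one]
  · intro x; rw [act_act, mul_inv_cancel, act_one]

lemma qfCode_act {n : ℕ} (σ : Equiv.Perm ℕ) (a : Fin n → ℕ) (x : StrL L) :
    qfCode a (act L σ⁻¹ x) = qfCode (σ ∘ a) x := rfl

lemma Invariant.measurePreserving {μ : Measure (StrL L)} (h : Invariant L μ)
    (σ : Equiv.Perm ℕ) : MeasurePreserving (act L σ) μ μ := by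
  refine ⟨measurable_act σ, Measure.ext fun X hX => ?_⟩
  rw [Measure.map_apply (measurable_act σ) hX, ← inv_inv σ, ← image_act, h _ _ hX]

/-- A structure in which the tuple `(0, …, n - 1)` has a given quantifier-free code. -/
def ofQfCode {n : ℕ} [NeZero n] (t : QfCode L n) : StrL L :=
  fun k r c => t k r fun i => Fin.ofNat n (c i)

lemma measurable_ofQfCode {n : ℕ} [NeZero n] :
    Measurable (ofQfCode : QfCode L n → StrL L) := by
  unfold ofQfCode
  fun_prop

lemma qfCode_ofQfCode {n : ℕ} [NeZero n] (t : QfCode L n) :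
    qfCode (fun i : Fin n => (i : ℕ)) (ofQfCode t) = t := by
  funext k r s
  simp [qfCode, ofQfCode]

lemma isQF_equal {n : ℕ} (i j : Fin n) :
    (Term.equal (Term.var i) (Term.var j) : L.Formula (Fin n)).IsQF :=
  (BoundedFormula.IsAtomic.equal _ _).isQF

section Realization

variable [L.IsRelational]

lemma exists_eq_var {n : ℕ} (t : L.Term (Fin n ⊕ Fin 0)) :
    ∃ i : Fin n, t = Term.var (Sum.inl i) := by
  cases t with
  | var v =>
    rcases v with i | i
    · exact ⟨i, rfl⟩
    · exact i.elim0
  | func f _ => exact isEmptyElim f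

lemma satF_bdEqual (x : StrL L) {n : ℕ} (i j : Fin n) (a : Fin n → ℕ) :
    SatF L x ((Term.var (Sum.inl i) : L.Term (Fin n ⊕ Fin 0)).bdEqual (Term.var (Sum.inl j))) a
      ↔ a i = a j := by
  let := toStructure L x
  simp [SatF, Formula.Realize]

lemma satF_rel (x : StrL L) {n k : ℕ} (r : L.Relations k) (s : Fin k → Fin n)
    (a : Fin n → ℕ) :
    SatF L x (r.boundedFormula fun i => (Term.var (Sum.inl (s i)) : L.Term (Fin n ⊕ Fin 0))) a
      ↔ qfCode a x k r s = true := by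
  let := toStructure L x
  simp only [SatF, Formula.Realize, BoundedFormula.realize_rel]
  rfl

lemma satF_imp (x : StrL L) {n : ℕ} (φ ψ : L.Formula (Fin n)) (a : Fin n → ℕ) :
    SatF L x (BoundedFormula.imp φ ψ) a ↔ (SatF L x φ a → SatF L x ψ a) :=
  Iff.rfl

lemma satF_congr {n : ℕ} {x y : StrL L} {a b : Fin n → ℕ} (ha : Function.Injective a)
    (hb : Function.Injective b) (h : qfCode a x = qfCode b y) {φ : L.Formula (Fin n)}
    (hφ : φ.IsQF) : SatF L x φ a ↔ SatF L y φ b := by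
  induction hφ with
  | falsum => exact Iff.rfl
  | of_isAtomic hat =>
    cases hat with
    | equal t₁ t₂ =>
      obtain ⟨i, rfl⟩ := exists_eq_var t₁
      obtain ⟨j, rfl⟩ := exists_eq_var t₂
      rw [satF_bdEqual, satF_bdEqual, ha.eq_iff, hb.eq_iff]
    | rel r ts =>
      choose s hs using fun i => exists_eq_var (ts i)
      obtain rfl : ts = fun i => Term.var (Sum.inl (s i)) := funext hs
      rw [satF_rel, satF_rel, h]
  | imp _ _ ih₁ ih₂ => rw [satF_imp, satF_imp, ih₁, ih₂]

lemma measurableSet_extF {n : ℕ} {φ : L.Formula (Fin n)} (hφ : φ.IsQF) (a : Fin n → ℕ) :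
    MeasurableSet (extF L φ a) := by
  unfold extF
  induction hφ with
  | falsum => exact MeasurableSet.empty
  | of_isAtomic hat =>
    cases hat with
    | equal t₁ t₂ =>
      obtain ⟨i, rfl⟩ := exists_eq_var t₁
      obtain ⟨j, rfl⟩ := exists_eq_var t₂
      simp only [satF_bdEqual]
      exact MeasurableSet.const _
    | rel r ts =>
      choose s hs using fun i => exists_eq_var (ts i)
      obtain rfl : ts = fun i => Term.var (Sum.inl (s i)) := funext hs
      simp only [satF_rel]
      exact measurableSet_eq_fun (by unfold qfCode; fun_prop) measurable_const
  | imp _ _ ih₁ ih₂ =>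
    simp only [satF_imp]
    exact ih₁.imp ih₂

/-- The quantifier-free type of `a` in `x`. -/
def qfType (x : StrL L) {n : ℕ} (a : Fin n → ℕ) : Set (L.Formula (Fin n)) :=
  {φ | φ.IsQF ∧ SatF L x φ a}

lemma isQfCompleteType_qfType (x : StrL L) {n : ℕ} (a : Fin n → ℕ) :
    IsQfCompleteType L n (qfType x a) :=
  ⟨ℕ, toStructure L x, a, rfl⟩

lemma satF_equal (x : StrL L) {n : ℕ} (i j : Fin n) (a : Fin n → ℕ) :
    SatF L x (Term.equal (Term.var i) (Term.var j)) a ↔ a i = a j := by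
  let := toStructure L x
  simp [SatF]

lemma nonRedundant_qfType (x : StrL L) {n : ℕ} {a : Fin n → ℕ} (ha : Function.Injective a) :
    NonRedundant L n (qfType x a) := fun i j hij =>
  ⟨(isQF_equal i j).not, fun h => hij (ha ((satF_equal x i j a).1 h))⟩

lemma injective_of_realizes {n : ℕ} {p : Set (L.Formula (Fin n))} (hp : NonRedundant L n p)
    {x : StrL L} {a : Fin n → ℕ} (ha : RealizesTypeIn L ℕ (toStructure L x) p a) :
    Function.Injective a := by
  intro i j hij
  by_contra hne
  exact ha _ (hp i j hne) ((satF_equal x i j a).2 hij)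

lemma eq_qfType_of_realizes {n : ℕ} {p : Set (L.Formula (Fin n))} (hp : IsQfCompleteType L n p)
    {x : StrL L} {a : Fin n → ℕ} (ha : RealizesTypeIn L ℕ (toStructure L x) p a) :
    p = qfType x a := by
  obtain ⟨M, iM, m, rfl⟩ := hp
  ext φ
  refine ⟨fun h => ⟨h.1, ha φ h⟩, fun h => ⟨h.1, ?_⟩⟩
  by_contra hn
  exact ha φ.not ⟨h.1.not, hn⟩ h.2

lemma realizes_qfType_iff {n : ℕ} {x : StrL L} {a b : Fin n → ℕ} (ha : Function.Injective a) :
    RealizesTypeIn L ℕ (toStructure L x) (qfType x a) b ↔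
      Function.Injective b ∧ qfCode b x = qfCode a x := by
  constructor
  · intro h
    refine ⟨injective_of_realizes (nonRedundant_qfType x ha) h, ?_⟩
    have heq := eq_qfType_of_realizes (isQfCompleteType_qfType x a) h
    funext k r s
    have hqf := (BoundedFormula.IsAtomic.rel r
      fun i => (Term.var (Sum.inl (s i)) : L.Term (Fin n ⊕ Fin 0))).isQF
    rw [Bool.eq_iff_iff, ← satF_rel, ← satF_rel]
    have := Set.ext_iff.1 heq
      (r.boundedFormula fun i => (Term.var (Sum.inl (s i)) : L.Term (Fin n ⊕ Fin 0)))
    exact ⟨fun h => (this.2 ⟨hqf, h⟩).2, fun h => (this.1 ⟨hqf, h⟩).2⟩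
  · rintro ⟨hb, h⟩ φ hφ
    exact (satF_congr hb ha h hφ.1).2 hφ.2

lemma chiRootedQfOn_iff {n : ℕ} {χ : L.Formula (Fin n)} (hχ : χ.IsQF) (x : StrL L) :
    ChiRootedQfOn L ℕ (toStructure L x) χ ↔
      ∀ a : Fin n → ℕ, Function.Injective a → SatF L x χ a →
        ∃ r, ∀ b : Fin n → ℕ, Function.Injective b → qfCode b x = qfCode a x → ∃ i, b i = r := by
  constructor
  · intro h a ha hsat
    obtain ⟨r, hr⟩ := h (qfType x a) (isQfCompleteType_qfType x a) (nonRedundant_qfType x ha)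
      ⟨hχ, hsat⟩ ⟨a, (realizes_qfType_iff ha).2 ⟨ha, rfl⟩⟩
    exact ⟨r, fun b hb hba => hr b ((realizes_qfType_iff ha).2 ⟨hb, hba⟩)⟩
  · rintro h p hp hnr hχp ⟨a, hpa⟩
    have ha := injective_of_realizes hnr hpa
    obtain rfl := eq_qfType_of_realizes hp hpa
    obtain ⟨r, hr⟩ := h a ha hχp.2
    exact ⟨r, fun b hb => hr b ((realizes_qfType_iff ha).1 hb).1 ((realizes_qfType_iff ha).1 hb).2⟩

end Realization

lemma exists_perm_comp_eq {n : ℕ} {a a' : Fin n → ℕ} (ha : Function.Injective a)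
    (ha' : Function.Injective a') : ∃ σ : Equiv.Perm ℕ, σ ∘ a = a' := by
  obtain ⟨σ, hσ⟩ := MulAction.isMultiplyPretransitive_iff.1
    (Equiv.Perm.isMultiplyPretransitive ℕ n) ⟨a, ha⟩ ⟨a', ha'⟩
  exact ⟨σ, funext fun i => DFunLike.congr_fun hσ i⟩

lemma exists_perm_comp_eq_pair {n : ℕ} {a b a' b' : Fin n → ℕ} (ha : Function.Injective a)
    (hb : Function.Injective b) (hab : Disjoint (range a) (range b))
    (ha' : Function.Injective a') (hb' : Function.Injective b')
    (hab' : Disjoint (range a') (range b')) :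
    ∃ σ : Equiv.Perm ℕ, σ ∘ a = a' ∧ σ ∘ b = b' := by
  have hinj {a b : Fin n → ℕ} (ha : Function.Injective a) (hb : Function.Injective b)
      (hab : Disjoint (range a) (range b)) : Function.Injective (Fin.append a b) :=
    Fin.append_injective_iff.2 ⟨ha, hb, fun i j h =>
      Set.disjoint_left.1 hab (mem_range_self i) (h ▸ mem_range_self j)⟩
  obtain ⟨σ, hσ⟩ := exists_perm_comp_eq (hinj ha hb hab) (hinj ha' hb' hab')
  refine ⟨σ, funext fun i => ?_, funext fun i => ?_⟩
  · simpa using congrFun hσ (Fin.castAdd n i)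
  · simpa only [Fin.append_right, Function.comp_apply] using congrFun hσ (Fin.natAdd n i)

lemma exists_perm_fixing (S : Finset ℕ) :
    ∃ τ : Equiv.Perm ℕ, (∀ (m : ℕ), ∀ y ∈ S, (τ ^ m) y = y) ∧
      ∀ y ∉ S, Function.Injective fun m : ℕ => (τ ^ m) y := by
  classical
  have : Infinite {y // y ∉ S} := S.finite_toSet.infinite_compl.to_subtype
  let := Encodable.ofCountable {y // y ∉ S}
  let := Denumerable.ofEncodableOfInfinite {y // y ∉ S}
  let e : ℤ ≃ {y // y ∉ S} := Denumerable.equiv₂ _ _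
  refine ⟨(Equiv.addRight (1 : ℤ)).extendDomain e, fun m y hy => ?_, fun y hy m k h => ?_⟩
  · rw [← Equiv.Perm.extendDomain_pow]
    exact Equiv.Perm.extendDomain_apply_not_subtype _ _ (by simpa using hy)
  · beta_reduce at h
    rw [← Equiv.Perm.extendDomain_pow, ← Equiv.Perm.extendDomain_pow,
      Equiv.Perm.extendDomain_apply_subtype (p := (· ∉ S)) _ _ hy,
      Equiv.Perm.extendDomain_apply_subtype (p := (· ∉ S)) _ _ hy,
      Subtype.coe_inj, e.apply_eq_iff_eq] at h
    simpa using h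

lemma eventually_notMem {τ : Equiv.Perm ℕ} {y : ℕ}
    (h : Function.Injective fun m : ℕ => (τ ^ m) y) (F : Finset ℕ) :
    ∀ᶠ m : ℕ in Filter.atTop, (τ ^ m) y ∉ F := by
  have := h.tendsto_cofinite.eventually F.finite_toSet.compl_mem_cofinite
  rw [Nat.cofinite_eq_atTop] at this
  exact this

lemma ae_recurrence [∀ n, Countable (L.Relations n)] {μ : Measure (StrL L)}
    [IsProbabilityMeasure μ] (hinv : Invariant L μ) {n : ℕ} (a b c : Fin n → ℕ)
    (hb : Function.Injective b) :
    ∀ᵐ x ∂μ, qfCode b x = qfCode a x → ∃ b' : Fin n → ℕ, Function.Injective b' ∧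
      qfCode b' x = qfCode a x ∧ range b' ∩ range c ⊆ range a ∩ range b := by
  obtain ⟨τ, hτ, hτ'⟩ := exists_perm_fixing (Finset.univ.image a)
  have hmem (i : Fin n) : a i ∈ Finset.univ.image a := Finset.mem_image_of_mem _ (Finset.mem_univ i)
  have hE : MeasurableSet {x : StrL L | qfCode b x = qfCode a x} :=
    measurableSet_eq_fun (measurable_qfCode b) (measurable_qfCode a)
  filter_upwards [(hinv.measurePreserving τ⁻¹).conservative.ae_mem_imp_frequently_image_mem
    hE.nullMeasurableSet] with x hx hab
  have hev : ∀ᶠ m : ℕ in Filter.atTop, ∀ i, b i ∉ Finset.univ.image a →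
      (τ ^ m) (b i) ∉ Finset.univ.image c := by
    rw [Filter.eventually_all]
    intro i
    by_cases hi : b i ∈ Finset.univ.image a
    · exact Filter.Eventually.of_forall fun m h => absurd hi h
    · exact (eventually_notMem (hτ' _ hi) _).mono fun m h _ => h
  obtain ⟨m, hm, hmc⟩ := ((hx hab).and_eventually hev).exists
  have hfix : (⇑(τ ^ m) ∘ a) = a := funext fun i => hτ m _ (hmem i)
  rw [act_iterate, inv_pow, qfCode_act, qfCode_act, hfix] at hm
  refine ⟨⇑(τ ^ m) ∘ b, (τ ^ m).injective.comp hb, hm, ?_⟩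
  rintro _ ⟨⟨i, rfl⟩, ⟨j, hj⟩⟩
  by_cases hi : b i ∈ Finset.univ.image a
  · have : (⇑(τ ^ m) ∘ b) i = b i := hτ m _ hi
    rw [this]
    exact ⟨by simpa using hi, mem_range_self i⟩
  · exact absurd (Finset.mem_image.2 ⟨j, Finset.mem_univ j, hj⟩) (hmc i hi)

/-- A family of finite tuples that pairwise intersect has a common point as soon as every member
can be moved generically over every other member. -/
lemma exists_root {n : ℕ} {F : Set (Fin n → ℕ)} (hne : F.Nonempty)
    (hdisj : ∀ a ∈ F, ∀ b ∈ F, ¬ Disjoint (range a) (range b))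
    (hmove : ∀ a ∈ F, ∀ b ∈ F, ∀ c ∈ F, ∃ b' ∈ F, range b' ∩ range c ⊆ range a ∩ range b) :
    ∃ r, ∀ b ∈ F, r ∈ range b := by
  by_contra! hroot
  obtain ⟨⟨a, b⟩, hab, hmin⟩ := exists_minimalFor_of_wellFoundedLT
    (fun p : (Fin n → ℕ) × (Fin n → ℕ) => p.1 ∈ F ∧ p.2 ∈ F)
    (fun p => (range p.1 ∩ range p.2).ncard) ⟨(hne.some, hne.some), hne.some_mem, hne.some_mem⟩
  obtain ⟨r, hra, hrb⟩ := Set.not_disjoint_iff.1 (hdisj a hab.1 b hab.2)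
  obtain ⟨c, hc, hrc⟩ := hroot r
  obtain ⟨b', hb', hsub⟩ := hmove a hab.1 b hab.2 c hc
  have hlt : (range b' ∩ range c).ncard < (range a ∩ range b).ncard :=
    Set.ncard_lt_ncard ⟨hsub, fun h => hrc (h ⟨hra, hrb⟩).2⟩
      ((finite_range a).inter_of_left _)
  exact absurd (hmin (j := (b', c)) ⟨hb', hc⟩ hlt.le) (not_le.2 hlt)

open scoped InnerProductSpace

lemma inner_eq_of_eventually_inner_iterate_eq {H : Type*} [NormedAddCommGroup H]
    [InnerProductSpace ℝ H] {U : H →L[ℝ] H} {u g : H} {c : ℝ}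
    (hg : Filter.Tendsto (birkhoffAverage ℝ U _root_.id · u) Filter.atTop (nhds g)) (w : H)
    (h : ∀ᶠ m : ℕ in Filter.atTop, ⟪w, U^[m] u⟫_ℝ = c) : ⟪w, g⟫_ℝ = c := by
  have h₁ : Filter.Tendsto (fun N => ⟪w, birkhoffAverage ℝ U _root_.id N u⟫_ℝ) Filter.atTop
      (nhds ⟪w, g⟫_ℝ) := tendsto_const_nhds.inner hg
  have h₂ := (tendsto_const_nhds.congr' (h.mono fun _ => Eq.symm)).cesaro
  refine tendsto_nhds_unique h₁ (h₂.congr fun N => ?_)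
  rw [birkhoffAverage, birkhoffSum, inner_smul_right, inner_sum]
  rfl

/-- The indicator in `L²` of the event that the code of `a` lies in `C`. -/
noncomputable def codeIndicator (μ : Measure (StrL L)) [IsProbabilityMeasure μ] {n : ℕ}
    {C : Set (QfCode L n)} (hC : MeasurableSet C) (a : Fin n → ℕ) : Lp ℝ 2 μ :=
  indicatorConstLp 2 (measurable_qfCode a hC) (measure_ne_top μ _) 1

/-- The unitary operator on `L²` induced by a permutation. -/
noncomputable def koopman {μ : Measure (StrL L)} (hinv : Invariant L μ) (σ : Equiv.Perm ℕ) :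
    Lp ℝ 2 μ →ₗᵢ[ℝ] Lp ℝ 2 μ :=
  Lp.compMeasurePreservingₗᵢ ℝ (act L σ⁻¹) (hinv.measurePreserving σ⁻¹)

section Independence

variable {μ : Measure (StrL L)} [IsProbabilityMeasure μ] {n : ℕ}
  {C D : Set (QfCode L n)} (hC : MeasurableSet C) (hD : MeasurableSet D)

lemma koopman_codeIndicator (hinv : Invariant L μ) (σ : Equiv.Perm ℕ) (a : Fin n → ℕ) :
    koopman hinv σ (codeIndicator μ hC a) = codeIndicator μ hC (σ ∘ a) :=
  Lp.indicatorConstLp_compMeasurePreserving _ _ _ _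

lemma inner_codeIndicator (a b : Fin n → ℕ) :
    ⟪codeIndicator μ hD b, codeIndicator μ hC a⟫_ℝ =
      μ.real (qfCode b ⁻¹' D ∩ qfCode a ⁻¹' C) :=
  L2.real_inner_indicatorConstLp_one_indicatorConstLp_one _ _

lemma inner_codeIndicator_eq (hinv : Invariant L μ) {a b a' b' : Fin n → ℕ}
    (ha : Function.Injective a) (hb : Function.Injective b) (hab : Disjoint (range a) (range b))
    (ha' : Function.Injective a') (hb' : Function.Injective b')
    (hab' : Disjoint (range a') (range b')) :
    ⟪codeIndicator μ hD b, codeIndicator μ hC a⟫_ℝ =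
      ⟪codeIndicator μ hD b', codeIndicator μ hC a'⟫_ℝ := by
  obtain ⟨σ, rfl, rfl⟩ := exists_perm_comp_eq_pair ha hb hab ha' hb' hab'
  rw [← koopman_codeIndicator hC hinv, ← koopman_codeIndicator hD hinv,
    LinearIsometry.inner_map_map]

lemma ae_const_of_koopman_eq (hμ : IsErgodicStructure L μ) {g : Lp ℝ 2 μ}
    (hg : ∀ σ, koopman hμ.2.1 σ g = g) : ∃ k : ℝ, g =ᵐ[μ] fun _ => k := by
  refine Filter.exists_eventuallyEq_const_of_forall_separating MeasurableSet fun U hU => ?_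
  have hX : MeasurableSet (g ⁻¹' U) := (Lp.stronglyMeasurable g).measurable hU
  have key (σ : Equiv.Perm ℕ) : μ (symmDiff (g ⁻¹' U) (act L σ '' (g ⁻¹' U))) = 0 := by
    have h₁ : g =ᵐ[μ] g ∘ act L σ⁻¹ := by
      have h₂ := Lp.coeFn_compMeasurePreserving g (hμ.2.1.measurePreserving σ⁻¹)
      have h₃ : Lp.compMeasurePreserving (act L σ⁻¹) (hμ.2.1.measurePreserving σ⁻¹) g = g := hg σ
      rwa [h₃] at h₂
    rw [image_act, measure_symmDiff_eq_zero_iff]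
    exact h₁.mono fun x hx => by
      simp only [eq_iff_iff]
      change g x ∈ U ↔ g (act L σ⁻¹ x) ∈ U
      rw [hx]; rfl
  rcases hμ.2.2 _ hX key with h | h
  · exact Or.inr (measure_eq_zero_iff_ae_notMem.1 h)
  · exact Or.inl ((mem_ae_iff_prob_eq_one hX).2 h)

lemma inner_codeIndicator_eq_mul (hμ : IsErgodicStructure L μ) {a b : Fin n → ℕ}
    (ha : Function.Injective a) (hb : Function.Injective b) (hab : Disjoint (range a) (range b)) :
    ⟪codeIndicator μ hD b, codeIndicator μ hC a⟫_ℝ =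
      μ.real (qfCode b ⁻¹' D) * μ.real (qfCode a ⁻¹' C) := by
  have hinv := hμ.2.1
  obtain ⟨τ, -, hτ⟩ := exists_perm_fixing ∅
  let U := (koopman hinv τ).toContinuousLinearMap
  have hiter (m : ℕ) : U^[m] (codeIndicator μ hC a) = codeIndicator μ hC (⇑(τ ^ m) ∘ a) := by
    induction m with
    | zero => rfl
    | succ m ih =>
      rw [Function.iterate_succ_apply', ih, pow_succ']
      exact koopman_codeIndicator hC hinv τ _
  obtain ⟨g, hg⟩ : ∃ g, Filter.Tendsto (birkhoffAverage ℝ U _root_.id · (codeIndicator μ hC a))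
      Filter.atTop (nhds g) :=
    ⟨_, U.tendsto_birkhoffAverage_orthogonalProjection
      (LinearIsometry.norm_toContinuousLinearMap_le _) _⟩
  -- Every translate of the initial tuple eventually becomes disjoint from a given tuple.
  have hdisj (d : Fin n → ℕ) :
      ∀ᶠ m : ℕ in Filter.atTop, Disjoint (range (⇑(τ ^ m) ∘ a)) (range d) := by
    have : ∀ᶠ m : ℕ in Filter.atTop, ∀ i, (τ ^ m) (a i) ∉ Finset.univ.image d :=
      Filter.eventually_all.2 fun i => eventually_notMem (hτ _ (Finset.notMem_empty _)) _
    refine this.mono fun m hm => Set.disjoint_left.2 ?_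
    rintro _ ⟨i, rfl⟩ hi
    exact hm i (by simpa using hi)
  have hinner {E : Set (QfCode L n)} (hE : MeasurableSet E) {d : Fin n → ℕ}
      (hd : Function.Injective d) :
      ⟪codeIndicator μ hE d, g⟫_ℝ = ⟪codeIndicator μ hE b, codeIndicator μ hC a⟫_ℝ := by
    refine inner_eq_of_eventually_inner_iterate_eq hg _ ((hdisj d).mono fun m hm => ?_)
    rw [hiter]
    exact inner_codeIndicator_eq hC hE hinv ((τ ^ m).injective.comp ha) hd hm ha hb hab
  set c := ⟪codeIndicator μ hC b, codeIndicator μ hC a⟫_ℝ with hc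
  have hgg : ⟪g, g⟫_ℝ = c := by
    refine inner_eq_of_eventually_inner_iterate_eq hg _ (Filter.Eventually.of_forall fun m => ?_)
    rw [hiter, real_inner_comm, hinner hC ((τ ^ m).injective.comp ha)]
  have hfix (σ : Equiv.Perm ℕ) : koopman hinv σ g = g := by
    have hσg : ⟪koopman hinv σ g, g⟫_ℝ = c := by
      refine inner_eq_of_eventually_inner_iterate_eq hg _ (Filter.Eventually.of_forall fun m => ?_)
      have h : codeIndicator μ hC (⇑(τ ^ m) ∘ a) =
          koopman hinv σ (codeIndicator μ hC (⇑(σ⁻¹ * τ ^ m) ∘ a)) := by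
        rw [koopman_codeIndicator, ← Function.comp_assoc, ← Equiv.Perm.coe_mul,
          mul_inv_cancel_left]
      rw [hiter, h, LinearIsometry.inner_map_map, real_inner_comm,
        hinner hC ((σ⁻¹ * τ ^ m).injective.comp ha)]
    rw [← sub_eq_zero, ← inner_self_eq_zero (𝕜 := ℝ), inner_sub_left, inner_sub_right,
      inner_sub_right, LinearIsometry.inner_map_map, real_inner_comm, hσg, hgg,
      real_inner_comm, hσg]
    ring
  obtain ⟨k, hk⟩ := ae_const_of_koopman_eq hμ hfix
  have hval {E : Set (QfCode L n)} (hE : MeasurableSet E) (d : Fin n → ℕ) :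
      ⟪codeIndicator μ hE d, g⟫_ℝ = μ.real (qfCode d ⁻¹' E) * k := by
    rw [codeIndicator, L2.inner_indicatorConstLp_one,
      setIntegral_congr_ae (g := fun _ => k) (measurable_qfCode d hE) (hk.mono fun x hx _ => hx)]
    simp
  have hk' : k = μ.real (qfCode a ⁻¹' C) := by
    have h := inner_eq_of_eventually_inner_iterate_eq hg (codeIndicator μ MeasurableSet.univ a)
      (c := μ.real (qfCode a ⁻¹' C)) (Filter.Eventually.of_forall fun m => ?_)
    · rw [hval] at h
      simpa using h
    · rw [hiter, inner_codeIndicator, ← (hinv.measurePreserving (τ ^ m)⁻¹).measureReal_preimage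
        (measurable_qfCode a hC).nullMeasurableSet]
      simp [qfCode_act, Set.preimage]
  rw [← hinner hD hb, hval, hk']

end Independence

lemma ae_not_disjoint_of_qfCode_eq [L.IsRelational] [∀ n, Countable (L.Relations n)]
    {μ : Measure (StrL L)} (hμ : IsErgodicStructure L μ) {n : ℕ} [NeZero n]
    {χ : L.Formula (Fin n)} (hqf : χ.IsQF)
    (hnull : ∀ p : Set (L.Formula (Fin n)), IsQfCompleteType L n p → NonRedundant L n p →
      χ ∈ p → μ (typeSet L p) = 0)
    {a b : Fin n → ℕ} (ha : Function.Injective a) (hb : Function.Injective b)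
    (hab : Disjoint (range a) (range b)) :
    ∀ᵐ x ∂μ, SatF L x χ a → qfCode b x ≠ qfCode a x := by
  have := hμ.1
  let ι : Fin n → ℕ := fun i => i
  have hι : Function.Injective ι := Fin.val_injective
  let K : Set (QfCode L n) := ofQfCode ⁻¹' extF L χ ι
  have hK : MeasurableSet K := measurable_ofQfCode (measurableSet_extF hqf ι)
  have hKnull (t : QfCode L n) (ht : t ∈ K) : μ (qfCode b ⁻¹' {t}) = 0 := by
    obtain ⟨σ, hσ⟩ := exists_perm_comp_eq hι hb
    have hb' : (qfCode b ⁻¹' {t} : Set (StrL L)) = act L σ⁻¹ ⁻¹' (qfCode ι ⁻¹' {t}) := by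
      rw [← hσ]
      rfl
    rw [hb', (hμ.2.1.measurePreserving σ⁻¹).measure_preimage
      (measurable_qfCode ι (measurableSet_singleton t)).nullMeasurableSet]
    refine measure_mono_null ?_ (hnull _ (isQfCompleteType_qfType (ofQfCode t) ι)
      (nonRedundant_qfType _ hι) ⟨hqf, ht⟩)
    intro x hx φ hφ
    exact (satF_congr hι hι ((qfCode_ofQfCode t).trans (Eq.symm hx)) hφ.1).1 hφ.2
  have hind : ProbabilityTheory.IndepFun (qfCode a) (qfCode b) μ := by
    rw [ProbabilityTheory.indepFun_iff_measure_inter_preimage_eq_mul]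
    intro D C hD hC
    have h := inner_codeIndicator_eq_mul hC hD hμ hb ha hab.symm
    rw [inner_codeIndicator] at h
    rw [← ofReal_measureReal, h, ENNReal.ofReal_mul measureReal_nonneg, ofReal_measureReal,
      ofReal_measureReal]
  have hE : MeasurableSet {q : QfCode L n × QfCode L n | q.1 ∈ K ∧ q.2 = q.1} :=
    (measurable_fst hK).inter (measurableSet_eq_fun measurable_snd measurable_fst)
  have hmap := (ProbabilityTheory.indepFun_iff_map_prod_eq_prod_map_map
    (measurable_qfCode a).aemeasurable (measurable_qfCode b).aemeasurable).1 hind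
  have hzero : μ {x : StrL L | qfCode a x ∈ K ∧ qfCode b x = qfCode a x} = 0 := by
    have h₁ : μ {x : StrL L | qfCode a x ∈ K ∧ qfCode b x = qfCode a x} =
        μ.map (fun x => (qfCode a x, qfCode b x)) {q | q.1 ∈ K ∧ q.2 = q.1} := by
      rw [Measure.map_apply ((measurable_qfCode a).prodMk (measurable_qfCode b)) hE]
      rfl
    rw [h₁, hmap]
    have := Measure.isProbabilityMeasure_map (μ := μ) (measurable_qfCode a).aemeasurable
    have := Measure.isProbabilityMeasure_map (μ := μ) (measurable_qfCode b).aemeasurable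
    rw [Measure.measure_prod_null hE]
    refine Filter.Eventually.of_forall fun t => ?_
    beta_reduce
    by_cases ht : t ∈ K
    · have h₂ : Prod.mk t ⁻¹' {q : QfCode L n × QfCode L n | q.1 ∈ K ∧ q.2 = q.1} = {t} := by
        ext s
        simp [ht]
      rw [h₂, Measure.map_apply (measurable_qfCode b) (measurableSet_singleton t)]
      exact hKnull t ht
    · have h₂ : Prod.mk t ⁻¹' {q : QfCode L n × QfCode L n | q.1 ∈ K ∧ q.2 = q.1} = ∅ := by
        ext s
        simp [ht]
      rw [h₂, measure_empty]
      rfl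
  refine (measure_eq_zero_iff_ae_notMem.1 hzero).mono fun x hx hsat heq => hx ⟨?_, heq⟩
  exact (satF_congr ha hι (qfCode_ofQfCode _).symm hqf).1 hsat

lemma measurableSet_chiRooted [L.IsRelational] [∀ n, Countable (L.Relations n)] {n : ℕ}
    {χ : L.Formula (Fin n)} (hqf : χ.IsQF) :
    MeasurableSet {x : StrL L | ChiRootedQfOn L ℕ (toStructure L x) χ} := by
  simp only [chiRootedQfOn_iff hqf]
  refine measurableSet_setOfPred.2 (Measurable.forall fun a => Measurable.imp measurable_const ?_)
  refine (measurableSet_setOfPred.1 (measurableSet_extF hqf a)).imp (Measurable.exists fun r =>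
    Measurable.forall fun b => measurable_const.imp (Measurable.imp ?_ measurable_const))
  exact (measurable_qfCode b).eq (measurable_qfCode a)

end Helpers

/-- The rootedness theorem (quantifier-free form): if μ is an ergodic structure and χ is a
quantifier-free formula of positive measure, null on redundant tuples, such that every
non-redundant complete quantifier-free n-type containing χ has measure 0, then μ-almost every
structure is χ-rooted with respect to quantifier-free types, and this set is Borel. -/
theorem statement10 [L.IsRelational] [∀ n, Countable (L.Relations n)]
    (μ : Measure (StrL L)) (hμ : IsErgodicStructure L μ)
    (n : ℕ) (hn : 1 ≤ n) (χ : L.Formula (Fin n)) (hqf : χ.IsQF)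
    (hpos : 0 < μ (extF L χ (fun i => (i : ℕ))))
    (hred : ∀ b : Fin n → ℕ, ¬ Function.Injective b → μ (extF L χ b) = 0)
    (hnull : ∀ p : Set (L.Formula (Fin n)), IsQfCompleteType L n p → NonRedundant L n p →
      χ ∈ p → μ (typeSet L p) = 0) :
    MeasurableSet {x : StrL L | ChiRootedQfOn L ℕ (toStructure L x) χ} ∧
    μ {x : StrL L | ChiRootedQfOn L ℕ (toStructure L x) χ} = 1 := by
  have := hμ.1
  have : NeZero n := ⟨by lia⟩
  refine ⟨measurableSet_chiRooted hqf,
    (mem_ae_iff_prob_eq_one (measurableSet_chiRooted hqf)).1 ?_⟩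
  have hdisj : ∀ᵐ x ∂μ, ∀ a b : Fin n → ℕ, Function.Injective a → Function.Injective b →
      Disjoint (range a) (range b) → SatF L x χ a → qfCode b x ≠ qfCode a x := by
    simp only [ae_all_iff]
    exact fun a b ha hb hab => ae_not_disjoint_of_qfCode_eq hμ hqf hnull ha hb hab
  have hrec : ∀ᵐ x ∂μ, ∀ a b c : Fin n → ℕ, Function.Injective b → qfCode b x = qfCode a x →
      ∃ b' : Fin n → ℕ, Function.Injective b' ∧ qfCode b' x = qfCode a x ∧
        range b' ∩ range c ⊆ range a ∩ range b := by
    simp only [ae_all_iff]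
    exact fun a b c hb => ae_recurrence hμ.2.1 a b c hb
  filter_upwards [hdisj, hrec] with x hx₁ hx₂
  refine (chiRootedQfOn_iff hqf x).2 fun a ha hsat => ?_
  let F : Set (Fin n → ℕ) := {b | Function.Injective b ∧ qfCode b x = qfCode a x}
  have hmeet : ∀ b ∈ F, ∀ c ∈ F, ¬ Disjoint (range b) (range c) := by
    rintro b ⟨hb, hba⟩ c ⟨hc, hca⟩ hbc
    exact hx₁ b c hb hc hbc ((satF_congr hb ha hba hqf).2 hsat) (hca.trans hba.symm)
  have hmove : ∀ b ∈ F, ∀ c ∈ F, ∀ d ∈ F,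
      ∃ c' ∈ F, range c' ∩ range d ⊆ range b ∩ range c := by
    rintro b ⟨hb, hba⟩ c ⟨hc, hca⟩ d -
    obtain ⟨c', hc', hcb, hsub⟩ := hx₂ b c d hc (hca.trans hba.symm)
    exact ⟨c', ⟨hc', hcb.trans hba⟩, hsub⟩
  obtain ⟨r, hr⟩ := exists_root (F := F) ⟨a, ha, rfl⟩ hmeet hmove
  exact ⟨r, fun b hb hba => hr b ⟨hb, hba⟩⟩

end Ergo
end
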